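/- arXiv:0810.0255 — 8 statements merged into one kernel-verified Lean document; each statement's English description precedes it below -/
import Mathlib

section
/- Let ω : ℝ → ℝ be continuously differentiable and satisfy the global hyperbolicity condition: there are constants 0 < c ≤ C with c ≤ ω'(u) ≤ C for all u ∈ ℝ. Let U : ℝ → ℝ be twice continuously differentiable and convex, and define Ω(u) = ∫₀ᵘ U'(v)·ω'(v) dv. Let g : ℝ → ℝ be any function with ω(g(x)) = x for all x ∈ ℝ (an inverse of ω, which exists since ω is a strictly increasing bijection of ℝ). Then the composition Ω ∘ g : ℝ → ℝ is convex. -/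
/-- The entropy flux composed with the inverse of the flux, `Ω ∘ ω⁻¹`, is convex,
under the global hyperbolicity condition `0 < c ≤ ω' ≤ C`. -/
theorem entropy_flux_comp_inverse_flux_convex
    (ω U Ω : ℝ → ℝ) (c C : ℝ) (hc : 0 < c) (hcC : c ≤ C)
    (hω : ContDiff ℝ 1 ω)
    (hω' : ∀ u, c ≤ deriv ω u ∧ deriv ω u ≤ C)
    (hU : ContDiff ℝ 2 U) (hUconv : ConvexOn ℝ Set.univ U)
    (hΩ : ∀ u, Ω u = ∫ v in (0:ℝ)..u, deriv U v * deriv ω v)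
    (g : ℝ → ℝ) (hg : ∀ x, ω (g x) = x) :
    ConvexOn ℝ Set.univ (Ω ∘ g) := by
  have hpos : ∀ u, 0 < deriv ω u := fun u => hc.trans_le (hω' u).1
  have hmono : StrictMono ω := strictMono_of_deriv_pos hpos
  have hg_mono : Monotone g := fun x y hxy => by
    rw [← hmono.le_iff_le, hg, hg]
    exact hxy
  have hg_surj : Function.Surjective g := fun u => ⟨ω u, hmono.injective (hg _)⟩
  have hg_cont : Continuous g := hg_mono.continuous_of_surjective hg_surj
  have hg_deriv : ∀ x, HasDerivAt g (deriv ω (g x))⁻¹ x := fun x =>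
    HasDerivAt.of_local_left_inverse hg_cont.continuousAt
      (hω.differentiable (by norm_num) (g x)).hasDerivAt (hpos _).ne' (.of_forall hg)
  have hcont : Continuous fun v => deriv U v * deriv ω v :=
    (hU.continuous_deriv (by norm_num)).mul (hω.continuous_deriv le_rfl)
  have hΩ_deriv : ∀ u, HasDerivAt Ω (deriv U u * deriv ω u) u := fun u => by
    rw [funext hΩ]
    exact hcont.integral_hasStrictDerivAt 0 u |>.hasDerivAt
  have hcomp : ∀ x, HasDerivAt (Ω ∘ g) (deriv U (g x)) x := fun x => by
    have h := (hΩ_deriv (g x)).comp x (hg_deriv x)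
    rwa [mul_inv_cancel_right₀ (hpos _).ne'] at h
  have hU_mono : Monotone (deriv U) := monotoneOn_univ.mp <|
    hUconv.monotoneOn_deriv fun x _ => hU.differentiable (by norm_num) x
  refine Monotone.convexOn_univ_of_deriv (fun x => (hcomp x).differentiableAt) ?_
  rw [funext fun x => (hcomp x).deriv]
  exact hU_mono.comp hg_mono
end

section
/- Let ω : ℝ → ℝ be continuously differentiable with c ≤ ω'(u) ≤ C for all u, where 0 < c ≤ C, let U : ℝ → ℝ be twice continuously differentiable and convex, and define Ω(u) = ∫₀ᵘ U'(v)·ω'(v) dv. Let N ≥ 1, let α₁, …, α_N be nonnegative reals with α₁ + ⋯ + α_N = 1, and let u, v₁, …, v_N be reals satisfying the flux decomposition ω(u) = Σⱼ αⱼ·ω(vⱼ). Then Ω(u) ≤ Σⱼ αⱼ·Ω(vⱼ). -/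
/-- Tangent inequality: for monotone `f` and nondecreasing `ω`, the integral of `f` against `dω`
dominates `f u` times the increment of `ω`, whatever the orientation of the interval. -/
theorem Monotone.mul_sub_le_integral_mul_deriv {f ω : ℝ → ℝ} (hf : Monotone f)
    (hfc : Continuous f) (hω : ContDiff ℝ 1 ω) (hω' : ∀ x, 0 ≤ deriv ω x) (u v : ℝ) :
    f u * (ω v - ω u) ≤ ∫ s in u..v, f s * deriv ω s := by
  have hdc : Continuous (deriv ω) := hω.continuous_deriv le_rfl
  have hint : ∫ s in u..v, f u * deriv ω s = f u * (ω v - ω u) := by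
    rw [intervalIntegral.integral_const_mul, intervalIntegral.integral_deriv_eq_sub
      (fun x _ => (hω.differentiable one_ne_zero) x) (hdc.intervalIntegrable _ _)]
  have hi₁ (a b : ℝ) := (hdc.const_mul (f u)).intervalIntegrable (μ := MeasureTheory.volume) a b
  have hi₂ (a b : ℝ) := (hfc.mul hdc).intervalIntegrable (μ := MeasureTheory.volume) a b
  rw [← hint]
  rcases le_total u v with h | h
  · exact intervalIntegral.integral_mono_on h (hi₁ _ _) (hi₂ _ _) fun s hs =>
      mul_le_mul_of_nonneg_right (hf hs.1) (hω' s)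
  · rw [intervalIntegral.integral_symm v u, intervalIntegral.integral_symm v u, neg_le_neg_iff]
    exact intervalIntegral.integral_mono_on h (hi₂ _ _) (hi₁ _ _) fun s hs =>
      mul_le_mul_of_nonneg_right (hf hs.2) (hω' s)

/-- Convex decomposition lemma: if `ω(u)` is a convex combination of the `ω(vⱼ)`,
then `Ω(u)` is bounded by the same convex combination of the `Ω(vⱼ)`. -/
theorem convex_decomposition_entropy
    (ω U Ω : ℝ → ℝ) (c C : ℝ) (hc : 0 < c) (hcC : c ≤ C)
    (hω : ContDiff ℝ 1 ω)
    (hω' : ∀ u, c ≤ deriv ω u ∧ deriv ω u ≤ C)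
    (hU : ContDiff ℝ 2 U) (hUconv : ConvexOn ℝ Set.univ U)
    (hΩ : ∀ u, Ω u = ∫ v in (0:ℝ)..u, deriv U v * deriv ω v)
    (N : ℕ) (hN : 1 ≤ N)
    (α : Fin N → ℝ) (hα : ∀ j, 0 ≤ α j) (hsum : ∑ j, α j = 1)
    (u : ℝ) (v : Fin N → ℝ)
    (hdecomp : ω u = ∑ j, α j * ω (v j)) :
    Ω u ≤ ∑ j, α j * Ω (v j) := by
  have hUd : Differentiable ℝ U := hU.differentiable two_ne_zero
  have hUc : Continuous (deriv U) := hU.continuous_deriv one_le_two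
  have hmono : Monotone (deriv U) :=
    monotoneOn_univ.mp (hUconv.monotoneOn_deriv fun x _ => hUd x)
  have hcont : Continuous fun s => deriv U s * deriv ω s :=
    hUc.mul (hω.continuous_deriv le_rfl)
  have tangent (w : ℝ) : Ω u + deriv U u * (ω w - ω u) ≤ Ω w := by
    have h := hmono.mul_sub_le_integral_mul_deriv hUc hω (fun x => hc.le.trans (hω' x).1) u w
    have hadd := intervalIntegral.integral_add_adjacent_intervals
      (hcont.intervalIntegrable (μ := MeasureTheory.volume) 0 u) (hcont.intervalIntegrable u w)
    rw [hΩ u, hΩ w]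
    linarith
  calc Ω u = (∑ j, α j) * (Ω u - deriv U u * ω u) + deriv U u * ∑ j, α j * ω (v j) := by
        rw [hsum, ← hdecomp]; ring
    _ = ∑ j, α j * (Ω u + deriv U u * (ω (v j) - ω u)) := by
        rw [Finset.sum_mul, Finset.mul_sum, ← Finset.sum_add_distrib]
        exact Finset.sum_congr rfl fun j _ => by ring
    _ ≤ ∑ j, α j * Ω (v j) :=
        Finset.sum_le_sum fun j _ => mul_le_mul_of_nonneg_left (tangent (v j)) (hα j)
end

section
/- Let ω : ℝ → ℝ be continuously differentiable with c ≤ ω'(u) ≤ C for all u, where 0 < c ≤ C, and let U : ℝ → ℝ be twice continuously differentiable with U''(u) ≥ m for all u, where m > 0. Define Ω(u) = ∫₀ᵘ U'(v)·ω'(v) dv. Let N ≥ 1, let α₁, …, α_N be nonnegative reals with α₁ + ⋯ + α_N = 1, and let u, v₁, …, v_N be reals satisfying ω(u) = Σⱼ αⱼ·ω(vⱼ). Then Ω(u) + (m·c²/(2C))·Σⱼ αⱼ·(vⱼ − u)² ≤ Σⱼ αⱼ·Ω(vⱼ). -/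
/-- A differentiable function whose derivative at `x` has the sign of `x - a` is minimal at `a`. -/
theorem le_of_hasDerivAt_of_sub_mul_nonneg {f f' : ℝ → ℝ} {a : ℝ}
    (hf : ∀ x, HasDerivAt f (f' x) x) (h : ∀ x, 0 ≤ (x - a) * f' x) (x : ℝ) : f a ≤ f x := by
  have hcont : Continuous f := continuous_iff_continuousAt.2 fun y => (hf y).continuousAt
  rcases le_total a x with hx | hx
  · refine monotoneOn_of_deriv_nonneg (convex_Ici a) hcont.continuousOn
      (fun y _ => (hf y).differentiableAt.differentiableWithinAt) (fun y hy => ?_)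
      Set.self_mem_Ici hx hx
    rw [interior_Ici, Set.mem_Ioi] at hy
    rw [(hf y).deriv]
    exact nonneg_of_mul_nonneg_right (h y) (sub_pos.2 hy)
  · refine antitoneOn_of_deriv_nonpos (convex_Iic a) hcont.continuousOn
      (fun y _ => (hf y).differentiableAt.differentiableWithinAt) (fun y hy => ?_)
      hx Set.self_mem_Iic hx
    rw [interior_Iic, Set.mem_Iio] at hy
    rw [(hf y).deriv]
    by_contra! hpos
    exact (h y).not_gt (mul_neg_of_neg_of_pos (sub_neg.2 hy) hpos)

/-- Quadratic lower bound for the relative entropy flux of a uniformly convex entropy. -/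
theorem sq_le_relative_entropy_flux {ω U Ω : ℝ → ℝ} {c m : ℝ} (hm : 0 < m)
    (hω : ContDiff ℝ 1 ω) (hω' : ∀ u, c ≤ deriv ω u) (hc : 0 < c)
    (hU : ContDiff ℝ 2 U) (hU'' : ∀ u, m ≤ deriv (deriv U) u)
    (hΩ : ∀ u, Ω u = ∫ v in (0:ℝ)..u, deriv U v * deriv ω v) (u v : ℝ) :
    m * c / 2 * (v - u) ^ 2 ≤ Ω v - Ω u - deriv U u * (ω v - ω u) := by
  have hU1 : ContDiff ℝ 1 (deriv U) := by
    rw [← one_add_one_eq_two, contDiff_succ_iff_deriv] at hU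
    exact hU.2.2
  have hdU : Differentiable ℝ (deriv U) := hU1.differentiable one_ne_zero
  have hdω : Differentiable ℝ ω := hω.differentiable one_ne_zero
  have hint : Continuous fun x => deriv U x * deriv ω x :=
    hU1.continuous.mul (hω.continuous_deriv le_rfl)
  have hΩd : ∀ x, HasDerivAt Ω (deriv U x * deriv ω x) x := fun x => by
    rw [funext hΩ]
    exact hint.integral_hasStrictDerivAt 0 x |>.hasDerivAt
  have hder : ∀ x, HasDerivAt
      (fun x => Ω x - deriv U u * ω x - m * c / 2 * (x - u) ^ 2)
      ((deriv U x - deriv U u) * deriv ω x - m * c * (x - u)) x := fun x => by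
    have hsq : HasDerivAt (fun x => m * c / 2 * (x - u) ^ 2) (m * c * (x - u)) x :=
      ((((hasDerivAt_id x).sub_const u).pow 2).const_mul (m * c / 2)).congr_deriv
        (by simp; ring)
    exact (((hΩd x).sub ((hdω x).hasDerivAt.const_mul (deriv U u))).sub hsq).congr_deriv (by ring)
  have hmin := le_of_hasDerivAt_of_sub_mul_nonneg (a := u) hder (fun x => ?_) v
  · simp only [sub_self] at hmin
    linarith
  · have hgrow : m * (x - u) ^ 2 ≤ (x - u) * (deriv U x - deriv U u) := by
      rcases le_total u x with hx | hx
      · nlinarith [mul_sub_le_image_sub_of_le_deriv hdU hU'' hx]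
      · nlinarith [mul_sub_le_image_sub_of_le_deriv hdU hU'' hx]
    have hlower : m * (x - u) ^ 2 * c ≤ (x - u) * (deriv U x - deriv U u) * deriv ω x :=
      mul_le_mul hgrow (hω' x) hc.le ((by positivity : 0 ≤ m * (x - u) ^ 2).trans hgrow)
    linarith

/-- Sharpened convex decomposition inequality with entropy dissipation for a
uniformly convex entropy `U` (with `U'' ≥ m > 0`). -/
theorem convex_decomposition_entropy_dissipation
    (ω U Ω : ℝ → ℝ) (c C m : ℝ) (hc : 0 < c) (hcC : c ≤ C) (hm : 0 < m)
    (hω : ContDiff ℝ 1 ω)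
    (hω' : ∀ u, c ≤ deriv ω u ∧ deriv ω u ≤ C)
    (hU : ContDiff ℝ 2 U)
    (hU'' : ∀ u, m ≤ deriv (deriv U) u)
    (hΩ : ∀ u, Ω u = ∫ v in (0:ℝ)..u, deriv U v * deriv ω v)
    (N : ℕ) (hN : 1 ≤ N)
    (α : Fin N → ℝ) (hα : ∀ j, 0 ≤ α j) (hsum : ∑ j, α j = 1)
    (u : ℝ) (v : Fin N → ℝ)
    (hdecomp : ω u = ∑ j, α j * ω (v j)) :
    Ω u + m * c ^ 2 / (2 * C) * ∑ j, α j * (v j - u) ^ 2 ≤ ∑ j, α j * Ω (v j) := by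
  have hC : 0 < C := hc.trans_le hcC
  have hcoef : m * c ^ 2 / (2 * C) ≤ m * c / 2 := by
    rw [div_le_div_iff₀ (by positivity) two_pos]
    nlinarith [mul_le_mul_of_nonneg_left hcC (mul_pos hm hc).le]
  have hpt : ∀ j, α j * (m * c ^ 2 / (2 * C) * (v j - u) ^ 2) ≤
      α j * (Ω (v j) - Ω u - deriv U u * (ω (v j) - ω u)) := fun j =>
    mul_le_mul_of_nonneg_left
      ((mul_le_mul_of_nonneg_right hcoef (sq_nonneg _)).trans
        (sq_le_relative_entropy_flux hm hω (fun x => (hω' x).1) hc hU hU'' hΩ u (v j)))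
      (hα j)
  have hrhs : ∑ j, α j * (Ω (v j) - Ω u - deriv U u * (ω (v j) - ω u)) =
      (∑ j, α j * Ω (v j)) - Ω u := by
    calc
      _ = ∑ j, (α j * Ω (v j) - α j * (Ω u - deriv U u * ω u)
            - deriv U u * (α j * ω (v j))) := Finset.sum_congr rfl fun j _ => by ring
      _ = _ := by
        rw [Finset.sum_sub_distrib, Finset.sum_sub_distrib, ← Finset.sum_mul, ← Finset.mul_sum,
          hsum, ← hdecomp]
        ring
  have hlhs : m * c ^ 2 / (2 * C) * ∑ j, α j * (v j - u) ^ 2 =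
      ∑ j, α j * (m * c ^ 2 / (2 * C) * (v j - u) ^ 2) := by
    rw [Finset.mul_sum]
    exact Finset.sum_congr rfl fun j _ => by ring
  have hle := Finset.sum_le_sum fun j (_ : j ∈ Finset.univ) => hpt j
  linarith
end

section
/- Let φ : ℝ → ℝ be continuously differentiable with φ'(u) ≥ c for all u, where c > 0. Let q : ℝ → ℝ → ℝ be continuously differentiable and satisfy the monotonicity property 0 ≤ ∂₁q(u,v) ≤ A and −B ≤ ∂₂q(u,v) ≤ 0 for all u, v, for some constants A, B ≥ 0. Let λ > 0 satisfy the CFL condition λ·(A + B) ≤ c, and define H(u,v) := φ(u) − λ·(q(u,v) − q(u,u)). Then H is nondecreasing in each of its two arguments, i.e., u ≤ u' implies H(u,v) ≤ H(u',v) for all v, and v ≤ v' implies H(u,v) ≤ H(u,v') for all u. -/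
/-- Under the CFL condition, the scheme function `H(u,v) = φ(u) − λ(q(u,v) − q(u,u))`
is nondecreasing in each of its arguments. -/
theorem scheme_function_monotone
    (φ : ℝ → ℝ) (c : ℝ) (hc : 0 < c)
    (hφ : ContDiff ℝ 1 φ) (hφ' : ∀ u, c ≤ deriv φ u)
    (q : ℝ → ℝ → ℝ) (hq : ContDiff ℝ 1 (Function.uncurry q))
    (A B : ℝ) (hA : 0 ≤ A) (hB : 0 ≤ B)
    (hq1 : ∀ u v, 0 ≤ deriv (fun x => q x v) u ∧ deriv (fun x => q x v) u ≤ A)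
    (hq2 : ∀ u v, -B ≤ deriv (fun y => q u y) v ∧ deriv (fun y => q u y) v ≤ 0)
    (lam : ℝ) (hlam : 0 < lam) (hCFL : lam * (A + B) ≤ c)
    (H : ℝ → ℝ → ℝ) (hH : ∀ u v, H u v = φ u - lam * (q u v - q u u)) :
    (∀ u u' v : ℝ, u ≤ u' → H u v ≤ H u' v) ∧
    (∀ u v v' : ℝ, v ≤ v' → H u v ≤ H u v') := by
  have hqd : Differentiable ℝ (Function.uncurry q) := hq.differentiable one_ne_zero
  have hd1 (v : ℝ) : Differentiable ℝ (fun x => q x v) :=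
    hqd.comp (differentiable_id.prodMk (differentiable_const v))
  have hd2 (u : ℝ) : Differentiable ℝ (fun y => q u y) :=
    hqd.comp ((differentiable_const u).prodMk differentiable_id)
  refine ⟨fun u u' v huu => ?_, fun u v v' hvv => ?_⟩
  · have hφ_growth := mul_sub_le_image_sub_of_le_deriv (hφ.differentiable one_ne_zero) hφ' huu
    have hq_upper := image_sub_le_mul_sub_of_deriv_le (hd1 v) (fun x => (hq1 x v).2) huu
    have hq_mono := mul_sub_le_image_sub_of_le_deriv (hd1 u') (fun x => (hq1 x u').1) huu
    have hq_lower := mul_sub_le_image_sub_of_le_deriv (hd2 u) (fun y => (hq2 u y).1) huu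
    have hdiag : q u' v - q u v - (q u' u' - q u u) ≤ (A + B) * (u' - u) := by linarith
    have hscaled := mul_le_mul_of_nonneg_left hdiag hlam.le
    have hcfl := mul_le_mul_of_nonneg_right hCFL (sub_nonneg.2 huu)
    rw [hH, hH]
    linarith
  · have hq_anti := image_sub_le_mul_sub_of_deriv_le (hd2 u) (fun y => (hq2 u y).2) hvv
    have hscaled := mul_le_mul_of_nonneg_left hq_anti hlam.le
    rw [hH, hH]
    linarith
end

section
/- Let φ : ℝ → ℝ be continuously differentiable with φ'(u) ≥ c for all u, where c > 0. Let q : ℝ → ℝ → ℝ be continuously differentiable with 0 ≤ ∂₁q(u,v) ≤ A and −B ≤ ∂₂q(u,v) ≤ 0 for all u, v, for some constants A, B ≥ 0, and let λ > 0 satisfy the CFL condition λ·(A + B) ≤ c. Define H(u,v) := φ(u) − λ·(q(u,v) − q(u,u)) and Q(u,v,c) := q(max(u,c), max(v,c)) − q(min(u,c), min(v,c)). Then for all reals u, v, c one has |H(u,v) − φ(c)| − |φ(u) − φ(c)| + λ·(Q(u,v,c) − Q(u,u,c)) ≤ 0. -/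
/-- The scheme function `φ(u) - λ (q(u, v) - q(u, u))` is monotone in `u` under the CFL condition
`λ (A + B) ≤ c`, for a monotone numerical flux `q`. -/
theorem scheme_function_monotone_left {φ : ℝ → ℝ} {q : ℝ → ℝ → ℝ} {A B c lam : ℝ}
    (hφ : ∀ a b, a ≤ b → c * (b - a) ≤ φ b - φ a)
    (hq1 : ∀ v, Monotone fun u => q u v)
    (hqA : ∀ v a b, a ≤ b → q b v - q a v ≤ A * (b - a))
    (hqB : ∀ u a b, a ≤ b → -B * (b - a) ≤ q u b - q u a)
    (hlam : 0 ≤ lam) (hCFL : lam * (A + B) ≤ c) (v : ℝ) :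
    Monotone fun u => φ u - lam * (q u v - q u u) := by
  intro a b hab
  have hdiff : (q b v - q b b) - (q a v - q a a) ≤ (A + B) * (b - a) := by
    have h : q a b ≤ q b b := hq1 b hab
    linarith [hqA v a b hab, hqB a a b hab]
  have hscaled := mul_le_mul_of_nonneg_left hdiff hlam
  have hcfl := mul_le_mul_of_nonneg_right hCFL (sub_nonneg.2 hab)
  dsimp only
  linarith [hφ a b hab]

/-- A function of two variables that is monotone in each of them satisfies the
bound `|H(u, v) - H(k, k)| ≤ H(u ∨ k, v ∨ k) - H(u ∧ k, v ∧ k)`. -/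
theorem abs_sub_diag_le_of_monotone {H : ℝ → ℝ → ℝ}
    (h1 : ∀ v, Monotone fun u => H u v) (h2 : ∀ u, Monotone (H u)) (u v k : ℝ) :
    |H u v - H k k| ≤ H (max u k) (max v k) - H (min u k) (min v k) := by
  have hmono : ∀ {a b x y : ℝ}, a ≤ b → x ≤ y → H a x ≤ H b y :=
    fun hab hxy => (h1 _ hab).trans (h2 _ hxy)
  have := hmono (le_max_left u k) (le_max_left v k)
  have := hmono (le_max_right u k) (le_max_right v k)
  have := hmono (min_le_left u k) (min_le_left v k)
  have := hmono (min_le_right u k) (min_le_right v k)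
  rw [abs_sub_le_iff]
  constructor <;> linarith

/-- A monotone function on a linear order turns distances of values into `max`/`min` differences. -/
theorem Monotone.abs_sub_eq_max_sub_min {α : Type*} [LinearOrder α] {f : α → ℝ}
    (hf : Monotone f) (a b : α) : |f a - f b| = f (max a b) - f (min a b) := by
  rw [hf.map_max, hf.map_min, max_sub_min_eq_abs, abs_sub_comm]

/-- Discrete entropy inequality for the faces, with Kruzkov entropies:
`|H(u,v) − φ(c)| − |φ(u) − φ(c)| + λ(Q(u,v,c) − Q(u,u,c)) ≤ 0`. -/
theorem discrete_entropy_inequality_faces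
    (φ : ℝ → ℝ) (c : ℝ) (hc : 0 < c)
    (hφ : ContDiff ℝ 1 φ) (hφ' : ∀ u, c ≤ deriv φ u)
    (q : ℝ → ℝ → ℝ) (hq : ContDiff ℝ 1 (Function.uncurry q))
    (A B : ℝ) (hA : 0 ≤ A) (hB : 0 ≤ B)
    (hq1 : ∀ u v, 0 ≤ deriv (fun x => q x v) u ∧ deriv (fun x => q x v) u ≤ A)
    (hq2 : ∀ u v, -B ≤ deriv (fun y => q u y) v ∧ deriv (fun y => q u y) v ≤ 0)
    (lam : ℝ) (hlam : 0 < lam) (hCFL : lam * (A + B) ≤ c)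
    (H : ℝ → ℝ → ℝ) (hH : ∀ u v, H u v = φ u - lam * (q u v - q u u))
    (Q : ℝ → ℝ → ℝ → ℝ)
    (hQ : ∀ u v cc, Q u v cc = q (max u cc) (max v cc) - q (min u cc) (min v cc)) :
    ∀ u v cc : ℝ,
      |H u v - φ cc| - |φ u - φ cc| + lam * (Q u v cc - Q u u cc) ≤ 0 := by
  have hdφ : Differentiable ℝ φ := hφ.differentiable one_ne_zero
  have hdq : Differentiable ℝ (Function.uncurry q) := hq.differentiable one_ne_zero
  have hd1 : ∀ v, Differentiable ℝ fun x => q x v := fun v =>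
    hdq.comp (differentiable_id.prodMk (differentiable_const v))
  have hd2 : ∀ u, Differentiable ℝ fun y => q u y := fun u =>
    hdq.comp ((differentiable_const u).prodMk differentiable_id)
  have hφc : ∀ a b, a ≤ b → c * (b - a) ≤ φ b - φ a := fun a b hab =>
    mul_sub_le_image_sub_of_le_deriv hdφ hφ' hab
  have hφmono : Monotone φ := monotone_of_deriv_nonneg hdφ fun u => hc.le.trans (hφ' u)
  have hH1 : ∀ v, Monotone fun u => H u v := fun v => by
    simp only [hH]
    exact scheme_function_monotone_left hφc
      (fun v => monotone_of_deriv_nonneg (hd1 v) fun u => (hq1 u v).1)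
      (fun v a b hab => image_sub_le_mul_sub_of_deriv_le (hd1 v) (fun u => (hq1 u v).2) hab)
      (fun u a b hab => mul_sub_le_image_sub_of_le_deriv (hd2 u) (fun v => (hq2 u v).1) hab)
      hlam.le hCFL v
  have hH2 : ∀ u, Monotone (H u) := fun u a b hab => by
    have h : q u b ≤ q u a := antitone_of_deriv_nonpos (hd2 u) (fun v => (hq2 u v).2) hab
    rw [hH, hH]
    gcongr
  intro u v k
  have hbound := abs_sub_diag_le_of_monotone hH1 hH2 u v k
  have hdiag : H k k = φ k := by rw [hH]; ring
  rw [hdiag, hH (max u k), hH (min u k)] at hbound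
  rw [hφmono.abs_sub_eq_max_sub_min u k, hQ, hQ]
  linarith
end

section
/- Let φ : ℝ → ℝ be continuously differentiable with φ'(u) ≥ c for all u, where c > 0. Let q : ℝ → ℝ → ℝ be continuously differentiable with 0 ≤ ∂₁q(u,v) ≤ A and −B ≤ ∂₂q(u,v) ≤ 0 for all u, v, for some constants A, B ≥ 0, and let λ > 0 satisfy the CFL condition λ·(A + B) ≤ c. Define H(u,v) := φ(u) − λ·(q(u,v) − q(u,u)). Then for all reals u, v one has φ(min(u,v)) ≤ H(u,v) ≤ φ(max(u,v)). In particular, the intermediate state ũ defined by φ(ũ) = H(u,v) satisfies min(u,v) ≤ ũ ≤ max(u,v). -/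
/-- Local maximum principle for the monotone scheme:
`φ(min(u,v)) ≤ H(u,v) ≤ φ(max(u,v))`, and the intermediate state `ũ` with
`φ(ũ) = H(u,v)` satisfies `min(u,v) ≤ ũ ≤ max(u,v)`. -/
theorem local_maximum_principle
    (φ : ℝ → ℝ) (c : ℝ) (hc : 0 < c)
    (hφ : ContDiff ℝ 1 φ) (hφ' : ∀ u, c ≤ deriv φ u)
    (q : ℝ → ℝ → ℝ) (hq : ContDiff ℝ 1 (Function.uncurry q))
    (A B : ℝ) (hA : 0 ≤ A) (hB : 0 ≤ B)
    (hq1 : ∀ u v, 0 ≤ deriv (fun x => q x v) u ∧ deriv (fun x => q x v) u ≤ A)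
    (hq2 : ∀ u v, -B ≤ deriv (fun y => q u y) v ∧ deriv (fun y => q u y) v ≤ 0)
    (lam : ℝ) (hlam : 0 < lam) (hCFL : lam * (A + B) ≤ c)
    (H : ℝ → ℝ → ℝ) (hH : ∀ u v, H u v = φ u - lam * (q u v - q u u)) :
    ∀ u v : ℝ,
      (φ (min u v) ≤ H u v ∧ H u v ≤ φ (max u v)) ∧
      (∀ ut : ℝ, φ ut = H u v → min u v ≤ ut ∧ ut ≤ max u v) := by
  have hφd : Differentiable ℝ φ := hφ.differentiable one_ne_zero
  have hmono : StrictMono φ := strictMono_of_deriv_pos fun u => hc.trans_le (hφ' u)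
  have hqd : ∀ u, Differentiable ℝ fun y => q u y := fun u =>
    (hq.differentiable one_ne_zero).comp
      ((differentiable_const u).prodMk differentiable_id)
  have hanti : ∀ u, Antitone fun y => q u y := fun u =>
    antitone_of_deriv_nonpos (hqd u) fun v => (hq2 u v).2
  have hlamB : lam * B ≤ c := by nlinarith [mul_nonneg hlam.le hA]
  have hincr : ∀ u v w, v ≤ w → lam * (q u v - q u w) ≤ φ w - φ v := by
    intro u v w hvw
    have hqvw : -B * (w - v) ≤ q u w - q u v :=
      mul_sub_le_image_sub_of_le_deriv (hqd u) (fun y => (hq2 u y).1) hvw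
    have hφvw : c * (w - v) ≤ φ w - φ v :=
      mul_sub_le_image_sub_of_le_deriv hφd hφ' hvw
    calc lam * (q u v - q u w) ≤ lam * (B * (w - v)) := by gcongr; linarith
      _ = lam * B * (w - v) := by ring
      _ ≤ c * (w - v) := mul_le_mul_of_nonneg_right hlamB (sub_nonneg.2 hvw)
      _ ≤ φ w - φ v := hφvw
  intro u v
  have hbounds : φ (min u v) ≤ H u v ∧ H u v ≤ φ (max u v) := by
    rw [hH]
    rcases le_total u v with huv | hvu
    · rw [min_eq_left huv, max_eq_right huv]
      have hle : q u v ≤ q u u := hanti u huv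
      constructor
      · nlinarith
      · linarith [hincr u u v huv]
    · rw [min_eq_right hvu, max_eq_left hvu]
      have hle : q u u ≤ q u v := hanti u hvu
      constructor
      · linarith [hincr u v u hvu]
      · nlinarith
  refine ⟨hbounds, fun ut hut => ?_⟩
  rw [← hut] at hbounds
  exact ⟨hmono.le_iff_le.1 hbounds.1, hmono.le_iff_le.1 hbounds.2⟩
end

section
/- Let N ≥ 1 and consider a periodic grid indexed by j ∈ ℤ/Nℤ. Let ω : ℝ → ℝ be continuously differentiable with ω'(u) ≥ c for all u, where c > 0. Let q : ℝ → ℝ → ℝ be continuously differentiable with 0 ≤ ∂₁q(u,v) ≤ A and −B ≤ ∂₂q(u,v) ≤ 0 for all u, v, for some constants A, B ≥ 0, and let λ > 0 satisfy the CFL condition 2λ·(A + B) ≤ c. Let u, u⁺ : ℤ/Nℤ → ℝ be related by the finite volume scheme ω(u⁺ⱼ) = ω(uⱼ) − λ·(q(uⱼ, uⱼ₊₁) − q(uⱼ₋₁, uⱼ)) for every j. Then for every real c̄ one has Σⱼ |ω(u⁺ⱼ) − ω(c̄)| ≤ Σⱼ |ω(uⱼ) − ω(c̄)|, where both sums run over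 j ∈ ℤ/Nℤ. -/
/-- A conservative three-point update which is monotone in each argument decreases the total
Kruzkov entropy on a periodic grid. -/
theorem sum_abs_sub_le_of_monotone_conservative {N : ℕ} [NeZero N]
    (ω : ℝ → ℝ) (F : ℝ → ℝ → ℝ) (hω : Monotone ω)
    (hmono : ∀ a a' b b' d d', a ≤ a' → b ≤ b' → d ≤ d' →
      ω b - (F b d - F a b) ≤ ω b' - (F b' d' - F a' b'))
    (u uplus : ZMod N → ℝ)
    (hscheme : ∀ j, ω (uplus j) = ω (u j) - (F (u j) (u (j + 1)) - F (u (j - 1)) (u j)))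
    (k : ℝ) :
    ∑ j, |ω (uplus j) - ω k| ≤ ∑ j, |ω (u j) - ω k| := by
  have telescope : ∀ w : ZMod N → ℝ,
      ∑ j, (ω (w j) - (F (w j) (w (j + 1)) - F (w (j - 1)) (w j))) = ∑ j, ω (w j) := by
    intro w
    have shift : ∑ j, F (w (j - 1)) (w j) = ∑ j, F (w j) (w (j + 1)) := by
      simpa using Equiv.sum_comp (Equiv.subRight (1 : ZMod N)) fun j => F (w j) (w (j + 1))
    simp only [Finset.sum_sub_distrib, shift, sub_self, sub_zero]
  have entropy : ∀ x, |ω x - ω k| = ω (max x k) - ω (min x k) := by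
    intro x
    rw [hω.map_max, hω.map_min, max_sub_min_eq_abs']
  simp only [entropy (u _), Finset.sum_sub_distrib]
  rw [← telescope fun j => max (u j) k, ← telescope fun j => min (u j) k,
    ← Finset.sum_sub_distrib]
  refine Finset.sum_le_sum fun j _ => ?_
  rw [hscheme]
  have upper := hmono (u (j - 1)) (max (u (j - 1)) k) (u j) (max (u j) k) (u (j + 1))
    (max (u (j + 1)) k) (le_max_left _ _) (le_max_left _ _) (le_max_left _ _)
  have upper_const := hmono k (max (u (j - 1)) k) k (max (u j) k) k
    (max (u (j + 1)) k) (le_max_right _ _) (le_max_right _ _) (le_max_right _ _)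
  have lower := hmono (min (u (j - 1)) k) (u (j - 1)) (min (u j) k) (u j)
    (min (u (j + 1)) k) (u (j + 1)) (min_le_left _ _) (min_le_left _ _) (min_le_left _ _)
  have lower_const := hmono (min (u (j - 1)) k) k (min (u j) k) k
    (min (u (j + 1)) k) k (min_le_right _ _) (min_le_right _ _) (min_le_right _ _)
  rw [abs_le]
  constructor <;> linarith

/-- Discrete periodic contraction property (Kruzkov entropy does not increase)
for the monotone finite volume scheme. -/
theorem periodic_scheme_kruzkov_contraction
    (N : ℕ) [NeZero N] (hN : 1 ≤ N)
    (ω : ℝ → ℝ) (c : ℝ) (hc : 0 < c)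
    (hω : ContDiff ℝ 1 ω) (hω' : ∀ u, c ≤ deriv ω u)
    (q : ℝ → ℝ → ℝ) (hq : ContDiff ℝ 1 (Function.uncurry q))
    (A B : ℝ) (hA : 0 ≤ A) (hB : 0 ≤ B)
    (hq1 : ∀ u v, 0 ≤ deriv (fun x => q x v) u ∧ deriv (fun x => q x v) u ≤ A)
    (hq2 : ∀ u v, -B ≤ deriv (fun y => q u y) v ∧ deriv (fun y => q u y) v ≤ 0)
    (lam : ℝ) (hlam : 0 < lam) (hCFL : 2 * lam * (A + B) ≤ c)
    (u uplus : ZMod N → ℝ)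
    (hscheme : ∀ j : ZMod N,
      ω (uplus j) = ω (u j) - lam * (q (u j) (u (j + 1)) - q (u (j - 1)) (u j)))
    (cbar : ℝ) :
    ∑ j : ZMod N, |ω (uplus j) - ω cbar| ≤ ∑ j : ZMod N, |ω (u j) - ω cbar| := by
  have hωd : Differentiable ℝ ω := hω.differentiable one_ne_zero
  have hqd : Differentiable ℝ (Function.uncurry q) := hq.differentiable one_ne_zero
  have hqd1 : ∀ v, Differentiable ℝ fun x => q x v := fun v =>
    hqd.comp (differentiable_id.prodMk (differentiable_const v))
  have hqd2 : ∀ x, Differentiable ℝ fun y => q x y := fun x =>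
    hqd.comp ((differentiable_const x).prodMk differentiable_id)
  refine sum_abs_sub_le_of_monotone_conservative ω (fun x y => lam * q x y)
    (monotone_of_deriv_nonneg hωd fun x => hc.le.trans (hω' x)) ?_ u uplus
    (fun j => by rw [hscheme j, mul_sub]) cbar
  intro a a' b b' d d' ha hb hd
  have left := monotone_of_deriv_nonneg (hqd1 b) (fun x => (hq1 x b).1) ha
  have right := antitone_of_deriv_nonpos (hqd2 b') (fun y => (hq2 b' y).2) hd
  have hωb := mul_sub_le_image_sub_of_le_deriv hωd hω' hb
  have hright := image_sub_le_mul_sub_of_deriv_le (hqd1 d) (fun x => (hq1 x d).2) hb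
  have hleft := mul_sub_le_image_sub_of_le_deriv (hqd2 a') (fun y => (hq2 a' y).1) hb
  have cfl : 0 ≤ (c - lam * (A + B)) * (b' - b) := by
    have := mul_nonneg hlam.le (add_nonneg hA hB)
    exact mul_nonneg (by linarith) (sub_nonneg.2 hb)
  dsimp only at left right hright hleft
  have flux := mul_le_mul_of_nonneg_left
    (add_le_add (add_le_add left right) (add_le_add hright (neg_le_neg hleft))) hlam.le
  linarith
end

section
/- Let N ≥ 1 and consider a periodic grid indexed by j ∈ ℤ/Nℤ. Let ω : ℝ → ℝ be continuously differentiable with ω'(u) ≥ c for all u, where c > 0. Let q : ℝ → ℝ → ℝ be continuously differentiable with 0 ≤ ∂₁q(u,v) ≤ A and −B ≤ ∂₂q(u,v) ≤ 0 for all u, v, for some constants A, B ≥ 0, and let λ > 0 satisfy the CFL condition 2λ·(A + B) ≤ c. Let u, u⁺ : ℤ/Nℤ → ℝ be related by the finite volume scheme ω(u⁺ⱼ) = ω(uⱼ) − λ·(q(uⱼ, uⱼ₊₁) − q(uⱼ₋₁, uⱼ)) for every j. Then min over j of uⱼ ≤ u⁺ₖ ≤ max over j of uⱼ for every k ∈ ℤ/Nℤ.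 -/
/-- Discrete periodic maximum principle for the monotone finite volume scheme. -/
theorem periodic_scheme_maximum_principle
    (N : ℕ) [NeZero N] (hN : 1 ≤ N)
    (ω : ℝ → ℝ) (c : ℝ) (hc : 0 < c)
    (hω : ContDiff ℝ 1 ω) (hω' : ∀ u, c ≤ deriv ω u)
    (q : ℝ → ℝ → ℝ) (hq : ContDiff ℝ 1 (Function.uncurry q))
    (A B : ℝ) (hA : 0 ≤ A) (hB : 0 ≤ B)
    (hq1 : ∀ u v, 0 ≤ deriv (fun x => q x v) u ∧ deriv (fun x => q x v) u ≤ A)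
    (hq2 : ∀ u v, -B ≤ deriv (fun y => q u y) v ∧ deriv (fun y => q u y) v ≤ 0)
    (lam : ℝ) (hlam : 0 < lam) (hCFL : 2 * lam * (A + B) ≤ c)
    (u uplus : ZMod N → ℝ)
    (hscheme : ∀ j : ZMod N,
      ω (uplus j) = ω (u j) - lam * (q (u j) (u (j + 1)) - q (u (j - 1)) (u j))) :
    ∀ k : ZMod N, (⨅ j : ZMod N, u j) ≤ uplus k ∧ uplus k ≤ ⨆ j : ZMod N, u j := by
  have hdq := hq.differentiable one_ne_zero
  have hd1 : ∀ v, Differentiable ℝ (fun x => q x v) := fun v =>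
    hdq.comp (differentiable_id.prodMk (differentiable_const v))
  have hd2 : ∀ u, Differentiable ℝ (fun y => q u y) := fun u =>
    hdq.comp ((differentiable_const u).prodMk differentiable_id)
  have mono1 : ∀ v, Monotone (fun x => q x v) := fun v =>
    monotone_of_deriv_nonneg (hd1 v) fun x => (hq1 x v).1
  have anti2 : ∀ u, Antitone (fun y => q u y) := fun u =>
    antitone_of_deriv_nonpos (hd2 u) fun y => (hq2 u y).2
  have lip1 : ∀ v x y, x ≤ y → q y v - q x v ≤ A * (y - x) := fun v x y hxy =>
    image_sub_le_mul_sub_of_deriv_le (hd1 v) (fun x => (hq1 x v).2) hxy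
  have lip2 : ∀ u x y, x ≤ y → -B * (y - x) ≤ q u y - q u x := fun u x y hxy =>
    mul_sub_le_image_sub_of_le_deriv (hd2 u) (fun y => (hq2 u y).1) hxy
  have hdω := hω.differentiable one_ne_zero
  have growth : ∀ x y, x ≤ y → c * (y - x) ≤ ω y - ω x := fun x y hxy =>
    mul_sub_le_image_sub_of_le_deriv hdω hω' hxy
  have hωmono : StrictMono ω := strictMono_of_deriv_pos fun x => hc.trans_le (hω' x)
  have hCFL' : lam * (A + B) ≤ c := by
    nlinarith [mul_nonneg hlam.le (add_nonneg hA hB)]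
  have hfin := Set.finite_range u
  intro k
  have hlow : ∀ j, (⨅ j, u j) ≤ u j := fun j => ciInf_le hfin.bddBelow j
  have hupp : ∀ j, u j ≤ ⨆ j, u j := fun j => le_ciSup hfin.bddAbove j
  generalize (⨅ j, u j) = m at hlow ⊢
  generalize (⨆ j, u j) = M at hupp ⊢
  constructor
  · rw [← hωmono.le_iff_le, hscheme k]
    have hflux : q (u k) (u (k + 1)) - q (u (k - 1)) (u k) ≤ (A + B) * (u k - m) := by
      have h1 : q m (u k) ≤ q (u (k - 1)) (u k) := mono1 _ (hlow _)
      have h2 : q (u k) (u (k + 1)) ≤ q (u k) m := anti2 _ (hlow _)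
      linarith [lip1 m m (u k) (hlow k), lip2 m m (u k) (hlow k)]
    have h3 := mul_le_mul_of_nonneg_left hflux hlam.le
    have h4 := mul_le_mul_of_nonneg_right hCFL' (sub_nonneg.2 (hlow k))
    linarith [growth m (u k) (hlow k)]
  · rw [← hωmono.le_iff_le, hscheme k]
    have hflux : q (u (k - 1)) (u k) - q (u k) (u (k + 1)) ≤ (A + B) * (M - u k) := by
      have h1 : q (u (k - 1)) (u k) ≤ q M (u k) := mono1 _ (hupp _)
      have h2 : q (u k) M ≤ q (u k) (u (k + 1)) := anti2 _ (hupp _)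
      linarith [lip1 M (u k) M (hupp k), lip2 M (u k) M (hupp k)]
    have h3 := mul_le_mul_of_nonneg_left hflux hlam.le
    have h4 := mul_le_mul_of_nonneg_right hCFL' (sub_nonneg.2 (hupp k))
    linarith [growth (u k) M (hupp k)]
end
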